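/- Define c₀(t) := inf{f(x) − f(x̄) : x ∈ D_x̄, T_M(x, x̄) = t} for t ≥ 0 (with inf ∅ = +∞) and L(x̄, ε) := {y ∈ D_x̄ : f(y) ≤ inf_{x ∈ D_x̄} f(x) + ε}. Then c₀ is an admissible function if and only if diam(L(x̄, ε)) → 0 as ε → 0. -/

import Mathlib

open Filter Topology Set
open scoped ENNReal

variable {X : Type*} [NormedAddCommGroup X] [NormedSpace ℝ X]

/-- The directional minimal time function `T_M(y,x) = inf {t ≥ 0 | ∃ m ∈ M, x = y + t•m}`,
with values in `[0,∞]` and `inf ∅ = ∞`. -/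
noncomputable def minTime (M : Set X) (y x : X) : ℝ≥0∞ :=
  sInf {t : ℝ≥0∞ | ∃ r : ℝ, 0 ≤ r ∧ t = ENNReal.ofReal r ∧ ∃ m ∈ M, x = y + r • m}

/-- The cone generated by `M`: `cone(M) = {t•m | t ≥ 0, m ∈ M}`. -/
def coneOf (M : Set X) : Set X := {p : X | ∃ t : ℝ, 0 ≤ t ∧ ∃ m ∈ M, p = t • m}

/-- `D_x := A ∩ dom T_M(·,x)`. -/
def Dset (M A : Set X) (x : X) : Set X := A ∩ {y : X | minTime M y x ≠ ⊤}

/-- `c₀(t) = inf {f(x) − f(x̄) | x ∈ D_x̄, T_M(x,x̄) = t}`, with `inf ∅ = +∞`. -/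
noncomputable def cZero (M A : Set X) (f : X → EReal) (xb : X) (t : ℝ) : EReal :=
  sInf {v : EReal | ∃ x ∈ Dset M A xb, minTime M x xb = ENNReal.ofReal t ∧ v = f x - f xb}

/-- The level set `L(x̄,ε) = {y ∈ D_x̄ | f(y) ≤ inf_{D_x̄} f + ε}`. -/
def Lset (M A : Set X) (f : X → EReal) (xb : X) (ε : ℝ) : Set X :=
  {y ∈ Dset M A xb | f y ≤ sInf (f '' Dset M A xb) + (ε : EReal)}

/-- A function `c : [0,∞) → [0,∞]` is admissible: `c(0) = 0` and every sequence
`(t_k) ⊆ [0,∞)` with `c(t_k) → 0` satisfies `t_k → 0`. -/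
def AdmissibleE (c : ℝ → EReal) : Prop :=
  c 0 = 0 ∧ ∀ t : ℕ → ℝ, (∀ k, 0 ≤ t k) →
    Tendsto (fun k => c (t k)) atTop (𝓝 0) → Tendsto t atTop (𝓝 0)

lemma minTime_eq_aux (M : Set X) (hMsph : M ⊆ Metric.sphere (0 : X) 1) (y x : X)
    (h : minTime M y x ≠ ⊤) : minTime M y x = ENNReal.ofReal (dist y x) := by
  have key : ∀ t : ℝ≥0∞, (∃ r : ℝ, 0 ≤ r ∧ t = ENNReal.ofReal r ∧ ∃ m ∈ M, x = y + r • m) →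
      t = ENNReal.ofReal (dist y x) := by
    rintro t ⟨r, hr, rfl, m, hm, rfl⟩
    have : ‖m‖ = 1 := by simpa using hMsph hm
    rw [dist_self_add_right, norm_smul, this, Real.norm_of_nonneg hr, mul_one]
  unfold minTime at h ⊢
  rcases Set.eq_empty_or_nonempty
    {t : ℝ≥0∞ | ∃ r : ℝ, 0 ≤ r ∧ t = ENNReal.ofReal r ∧ ∃ m ∈ M, x = y + r • m} with he | ⟨t, ht⟩
  · rw [he] at h
    simp at h
  · apply le_antisymm
    · rw [← key t ht]
      exact sInf_le ht
    · exact le_sInf fun u hu => (key u hu).ge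

lemma self_mem_Dset_aux (M A : Set X) (hMne : M.Nonempty) (xb : X) (hxb : xb ∈ A) :
    xb ∈ Dset M A xb := by
  obtain ⟨m, hm⟩ := hMne
  refine ⟨hxb, ?_⟩
  have : minTime M xb xb ≤ 0 := sInf_le ⟨0, le_rfl, by simp, m, hm, by simp⟩
  exact (this.trans_lt (by simp)).ne

/-- Theorem 4.2: `c₀` is admissible iff `diam(L(x̄,ε)) → 0` as `ε → 0⁺`. -/
theorem cZero_admissible_iff_diam [CompleteSpace X]
    (M : Set X) (hMne : M.Nonempty) (hMcl : IsClosed M)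
    (hMsph : M ⊆ Metric.sphere (0 : X) 1) (hMcone : Convex ℝ (coneOf M))
    (A : Set X) (hAne : A.Nonempty) (hAcl : IsClosed A) (hAconv : Convex ℝ A)
    (f : X → EReal) (hbot : ∀ x, f x ≠ ⊥)
    (xb : X) (hxb : xb ∈ A) (hfxb : f xb ≠ ⊤)
    (hmin : ∀ x ∈ Dset M A xb, f xb ≤ f x)
    (hsub : ∀ x ∈ Dset M A xb, ∀ s : ℝ, 0 ≤ s → s ≤ 1 →
      f (s • x + (1 - s) • xb) ≤ (s : EReal) * f x + ((1 - s : ℝ) : EReal) * f xb) :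
    AdmissibleE (cZero M A f xb) ↔
      Tendsto (fun ε : ℝ => EMetric.diam (Lset M A f xb ε)) (𝓝[>] 0) (𝓝 0) := by
  have hD := self_mem_Dset_aux M A hMne xb hxb
  have hT : ∀ y ∈ Dset M A xb, minTime M y xb = ENNReal.ofReal (dist y xb) :=
    fun y hy => minTime_eq_aux M hMsph y xb hy.2
  have hinf : sInf (f '' Dset M A xb) = f xb := by
    apply le_antisymm
    · exact sInf_le ⟨xb, hD, rfl⟩
    · apply le_sInf
      rintro _ ⟨x, hx, rfl⟩
      exact hmin x hx
  obtain ⟨a, ha⟩ : ∃ a : ℝ, f xb = a := ⟨(f xb).toReal, (EReal.coe_toReal hfxb (hbot xb)).symm⟩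
  have hL : ∀ ε y, y ∈ Lset M A f xb ε ↔ y ∈ Dset M A xb ∧ f y ≤ (a : EReal) + (ε : EReal) := by
    intro ε y
    simp only [Lset, hinf, ha, Set.mem_setOf_eq]
  have hsubiff : ∀ (v : EReal) (ε : ℝ), v - (a : EReal) ≤ (ε : EReal) ↔ v ≤ (a : EReal) + ε := by
    intro v ε
    induction v with
    | bot => simp
    | top => simp [← EReal.coe_add]
    | coe v => norm_cast; constructor <;> intro h <;> linarith
  have hc0 : ∀ t, 0 ≤ cZero M A f xb t := by
    intro t
    apply le_sInf
    rintro _ ⟨x, hx, -, rfl⟩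
    rw [EReal.sub_nonneg (Or.inr hfxb) (Or.inr (hbot xb))]
    exact hmin x hx
  constructor
  · rintro ⟨-, hadm⟩
    have key : ∀ δ : ℝ, 0 < δ → ∃ ε : ℝ, 0 < ε ∧ ∀ y ∈ Lset M A f xb ε, dist y xb ≤ δ := by
      intro δ hδ
      by_contra! hcon
      have hpos : ∀ k : ℕ, (0 : ℝ) < 1 / ((k : ℝ) + 1) := fun k => by positivity
      choose y hy hyd using fun k : ℕ => hcon (1 / ((k : ℝ) + 1)) (hpos k)
      have hlim : Tendsto (fun k : ℕ => (((1 / ((k : ℝ) + 1) : ℝ)) : EReal)) atTop (𝓝 0) := by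
        have := (continuous_coe_real_ereal.tendsto 0).comp
          (tendsto_one_div_add_atTop_nhds_zero_nat (𝕜 := ℝ))
        simpa [Function.comp_def] using this
      have h1 := hadm (fun k => dist (y k) xb) (fun k => dist_nonneg)
        (tendsto_of_tendsto_of_tendsto_of_le_of_le tendsto_const_nhds hlim (fun k => hc0 _)
          (fun k => by
            obtain ⟨h1, h2⟩ := (hL _ _).1 (hy k)
            refine le_trans (sInf_le ⟨y k, h1, hT _ h1, rfl⟩) ?_
            rw [ha]
            exact (hsubiff _ _).2 h2))
      obtain ⟨k, hk⟩ := (h1.eventually (gt_mem_nhds hδ)).exists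
      exact absurd hk (not_lt.2 (hyd k).le)
    rw [ENNReal.tendsto_nhds_zero]
    intro η hη
    by_cases hηt : η = ⊤
    · simp [hηt]
    have hη' : 0 < η.toReal := ENNReal.toReal_pos hη.ne' hηt
    obtain ⟨ε, hε, h⟩ := key (η.toReal / 2) (by positivity)
    filter_upwards [Ioo_mem_nhdsGT hε] with e he
    apply Metric.ediam_le
    have hmono : ∀ y ∈ Lset M A f xb e, dist y xb ≤ η.toReal / 2 := by
      intro y hy
      apply h
      rw [hL] at hy ⊢
      refine ⟨hy.1, hy.2.trans ?_⟩
      exact_mod_cast (by linarith [he.2] : a + e ≤ a + ε)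
    intro x hx y hy
    rw [edist_dist]
    apply ENNReal.ofReal_le_of_le_toReal
    linarith [dist_triangle_right x y xb, hmono x hx, hmono y hy]
  · intro hdiam
    refine ⟨le_antisymm (sInf_le ⟨xb, hD, ?_, ?_⟩) (hc0 0), ?_⟩
    · simp [hT xb hD]
    · rw [ha, ← EReal.coe_sub]; simp
    · intro t ht hlim
      rw [Metric.tendsto_nhds]
      intro δ hδ
      have h1 := hdiam.eventually (gt_mem_nhds (ENNReal.ofReal_pos.2 hδ))
      obtain ⟨ε, hεd, hε⟩ := (h1.and self_mem_nhdsWithin).exists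
      have hε : 0 < ε := hε
      filter_upwards [hlim.eventually (gt_mem_nhds (EReal.coe_pos.2 hε))] with k hk
      obtain ⟨_, ⟨x, hx, hxt, rfl⟩, hlt⟩ := sInf_lt_iff.1 hk
      rw [ha] at hlt
      have hxL : x ∈ Lset M A f xb ε := (hL _ _).2 ⟨hx, (hsubiff _ _).1 hlt.le⟩
      have hbL : xb ∈ Lset M A f xb ε := by
        rw [hL, ha]
        exact ⟨hD, by exact_mod_cast (by linarith : a ≤ a + ε)⟩
      have h2 := (Metric.edist_le_ediam_of_mem hxL hbL).trans_lt hεd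
      rw [edist_dist, ← hT x hx, hxt, ENNReal.ofReal_lt_ofReal_iff hδ] at h2
      rw [Real.dist_eq, sub_zero, abs_of_nonneg (ht k)]
      exact h2
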